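/- Assume Cone(N,N) = C, i.e., for every object X of C there exists a distinguished triangle N' ⟶ N₀ ⟶ X ⟶ N'⟦1⟧ with N₀, N' ∈ N. Then every morphism α: Q(A) ⟶ Q(B) in D (for objects A, B of C) admits a factorization α = α₂ ∘ α₁ where α₁ is an epimorphism and α₂ is a monomorphism in D. -/

import Mathlib

open CategoryTheory CategoryTheory.Limits CategoryTheory.Pretriangulated

universe v u v₂ u₂

variable {C : Type u} [Category.{v} C] [Preadditive C] [HasZeroObject C]
  [HasShift C ℤ] [∀ n : ℤ, (shiftFunctor C n).Additive] [Pretriangulated C]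

/-- `f : X ⟶ Y` factors through an object of `N`. -/
def FactorsThru (N : Set C) {X Y : C} (f : X ⟶ Y) : Prop :=
  ∃ (Z : C) (_ : Z ∈ N) (u : X ⟶ Z) (v : Z ⟶ Y), f = u ≫ v

/-- The morphism `X⟦-1⟧ ⟶ A` obtained from `h : X ⟶ A⟦1⟧` by shifting by `-1` and
composing with the canonical isomorphism `A⟦1⟧⟦-1⟧ ≅ A`. -/
noncomputable def descShift {X A : C} (h : X ⟶ A⟦(1:ℤ)⟧) : X⟦(-1:ℤ)⟧ ⟶ A :=
  h⟦(-1:ℤ)⟧' ≫ (shiftEquiv C (1:ℤ)).unitIso.inv.app A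

/-- The class `S_N` of morphisms fitting in a distinguished triangle whose two other
maps factor through `N`. -/
def SN (N : Set C) {B C₀ : C} (g : B ⟶ C₀) : Prop :=
  ∃ (A : C) (f : A ⟶ B) (h : C₀ ⟶ A⟦(1:ℤ)⟧),
    (Triangle.mk f g h ∈ distTriang C) ∧ FactorsThru N f ∧ FactorsThru N h

/-- The class `L`. -/
def ClassL (N : Set C) {A B : C} (f : A ⟶ B) : Prop :=
  ∃ (N₀ : C) (_ : N₀ ∈ N) (g : B ⟶ N₀) (h : N₀ ⟶ A⟦(1:ℤ)⟧),
    (Triangle.mk f g h ∈ distTriang C) ∧ FactorsThru N (descShift h)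

/-- The class `R`. -/
def ClassR (N : Set C) {B C₀ : C} (g : B ⟶ C₀) : Prop :=
  ∃ (N₀ : C) (_ : N₀ ∈ N) (f : N₀ ⟶ B) (h : C₀ ⟶ N₀⟦(1:ℤ)⟧),
    (Triangle.mk f g h ∈ distTriang C) ∧ FactorsThru N h

/-- Condition (Lex) on a morphism `h : C₀ ⟶ A⟦1⟧`. -/
def LexCond (N : Set C) {C₀ A : C} (h : C₀ ⟶ A⟦(1:ℤ)⟧) : Prop :=
  ∀ (N₀ : C), N₀ ∈ N → ∀ (x : N₀ ⟶ C₀), FactorsThru N (descShift (x ≫ h))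

/-- Condition (Rex) on a morphism `h : C₀ ⟶ A⟦1⟧`. -/
def RexCond (N : Set C) {C₀ A : C} (h : C₀ ⟶ A⟦(1:ℤ)⟧) : Prop :=
  ∀ (N₀ : C), N₀ ∈ N → ∀ (y : A ⟶ N₀),
    ∃ (M : C) (_ : M ∈ N) (u : C₀⟦(-1:ℤ)⟧ ⟶ M⟦(-1:ℤ)⟧) (v : M⟦(-1:ℤ)⟧ ⟶ N₀),
      descShift h ≫ y = u ≫ v

/-- `S_N` as a morphism property. -/
def SNProp (N : Set C) : MorphismProperty C := fun _ _ g => SN N g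


/-! ### Exactness properties of distinguished triangles, in terms of their components -/

namespace DistTriangle

variable {X Y Z : C} {f : X ⟶ Y} {g : Y ⟶ Z} {h : Z ⟶ X⟦(1 : ℤ)⟧}

lemma comp_zero₁₂ (hT : Triangle.mk f g h ∈ distTriang C) : f ≫ g = 0 :=
  comp_distTriang_mor_zero₁₂ _ hT

lemma comp_zero₂₃ (hT : Triangle.mk f g h ∈ distTriang C) : g ≫ h = 0 :=
  comp_distTriang_mor_zero₂₃ _ hT

lemma comp_zero₃₁ (hT : Triangle.mk f g h ∈ distTriang C) : h ≫ f⟦(1 : ℤ)⟧' = 0 :=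
  comp_distTriang_mor_zero₃₁ _ hT

lemma rotate (hT : Triangle.mk f g h ∈ distTriang C) :
    Triangle.mk g h (-f⟦(1 : ℤ)⟧') ∈ distTriang C :=
  rot_of_distTriang _ hT

lemma desc₂ (hT : Triangle.mk f g h ∈ distTriang C) {W : C} (φ : Y ⟶ W) (hφ : f ≫ φ = 0) :
    ∃ ψ : Z ⟶ W, φ = g ≫ ψ :=
  Triangle.yoneda_exact₂ _ hT φ hφ

lemma desc₃ (hT : Triangle.mk f g h ∈ distTriang C) {W : C} (φ : Z ⟶ W) (hφ : g ≫ φ = 0) :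
    ∃ ψ : X⟦(1 : ℤ)⟧ ⟶ W, φ = h ≫ ψ :=
  Triangle.yoneda_exact₃ _ hT φ hφ

lemma lift₂ (hT : Triangle.mk f g h ∈ distTriang C) {W : C} (φ : W ⟶ Y) (hφ : φ ≫ g = 0) :
    ∃ ψ : W ⟶ X, φ = ψ ≫ f :=
  Triangle.coyoneda_exact₂ _ hT φ hφ

lemma lift₃ (hT : Triangle.mk f g h ∈ distTriang C) {W : C} (φ : W ⟶ Z) (hφ : φ ≫ h = 0) :
    ∃ ψ : W ⟶ Y, φ = ψ ≫ g :=
  Triangle.coyoneda_exact₃ _ hT φ hφ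

variable {X' Y' Z' : C} {f' : X' ⟶ Y'} {g' : Y' ⟶ Z'} {h' : Z' ⟶ X'⟦(1 : ℤ)⟧}

lemma complete₁ (hT : Triangle.mk f g h ∈ distTriang C) (hT' : Triangle.mk f' g' h' ∈ distTriang C)
    (b : Y ⟶ Y') (c : Z ⟶ Z') (comm : g ≫ c = b ≫ g') :
    ∃ a : X ⟶ X', f ≫ b = a ≫ f' ∧ h ≫ a⟦(1 : ℤ)⟧' = c ≫ h' :=
  complete_distinguished_triangle_morphism₁ _ _ hT hT' b c comm

lemma complete₂ (hT : Triangle.mk f g h ∈ distTriang C) (hT' : Triangle.mk f' g' h' ∈ distTriang C)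
    (a : X ⟶ X') (c : Z ⟶ Z') (comm : h ≫ a⟦(1 : ℤ)⟧' = c ≫ h') :
    ∃ b : Y ⟶ Y', f ≫ b = a ≫ f' ∧ g ≫ c = b ≫ g' :=
  complete_distinguished_triangle_morphism₂ _ _ hT hT' a c comm

lemma complete₃ (hT : Triangle.mk f g h ∈ distTriang C) (hT' : Triangle.mk f' g' h' ∈ distTriang C)
    (a : X ⟶ X') (b : Y ⟶ Y') (comm : f ≫ b = a ≫ f') :
    ∃ c : Z ⟶ Z', g ≫ c = b ≫ g' ∧ h ≫ a⟦(1 : ℤ)⟧' = c ≫ h' :=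
  complete_distinguished_triangle_morphism _ _ hT hT' a b comm

lemma exists_extension (hT : Triangle.mk f g h ∈ distTriang C) {W : C} (φ : X ⟶ W)
    (hφ : h ≫ φ⟦(1 : ℤ)⟧' = 0) : ∃ b : Y ⟶ W, f ≫ b = φ := by
  have hW : Triangle.mk (𝟙 W) (0 : W ⟶ _) 0 ∈ distTriang C := contractible_distinguished W
  obtain ⟨b, hb, -⟩ := complete₂ hT hW φ 0 (by rw [hφ, zero_comp])
  exact ⟨b, by rw [hb, Category.comp_id]⟩

end DistTriangle

/-! ### Morphisms factoring through `N` -/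

namespace FactorsThru

omit [HasZeroObject C] [∀ n : ℤ, (shiftFunctor C n).Additive] [Pretriangulated C]

variable {N : Set C}

lemma of_mem_left {X Y : C} (f : X ⟶ Y) (hX : X ∈ N) : FactorsThru N f :=
  ⟨X, hX, 𝟙 X, f, by simp⟩

lemma of_mem_right {X Y : C} (f : X ⟶ Y) (hY : Y ∈ N) : FactorsThru N f :=
  ⟨Y, hY, f, 𝟙 Y, by simp⟩

lemma comp_left {X Y Z : C} (g : X ⟶ Y) {f : Y ⟶ Z} (hf : FactorsThru N f) :
    FactorsThru N (g ≫ f) := by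
  obtain ⟨P, hP, u, w, rfl⟩ := hf
  exact ⟨P, hP, g ≫ u, w, by simp⟩

lemma comp_right {X Y Z : C} {f : X ⟶ Y} (hf : FactorsThru N f) (g : Y ⟶ Z) :
    FactorsThru N (f ≫ g) := by
  obtain ⟨P, hP, u, w, rfl⟩ := hf
  exact ⟨P, hP, u, w ≫ g, by simp⟩

lemma neg {X Y : C} {f : X ⟶ Y} (hf : FactorsThru N f) : FactorsThru N (-f) := by
  simpa using hf.comp_right (-𝟙 Y)

end FactorsThru

/-- A class of objects containing the zero objects and closed under extensions. -/
structure IsExtensionClosed (N : Set C) : Prop where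
  zero : ∀ X : C, IsZero X → X ∈ N
  ext : ∀ T : Triangle C, (T ∈ distTriang C) → T.obj₁ ∈ N → T.obj₃ ∈ N → T.obj₂ ∈ N

/-- `g` is a monomorphism modulo the morphisms factoring through `N`. -/
def IsMonoMod (N : Set C) {B E : C} (g : B ⟶ E) : Prop :=
  ∀ ⦃X : C⦄ (x : X ⟶ B), FactorsThru N (x ≫ g) → FactorsThru N x

/-- `g` is an epimorphism modulo the morphisms factoring through `N`. -/
def IsEpiMod (N : Set C) {B E : C} (g : B ⟶ E) : Prop :=
  ∀ ⦃Y : C⦄ (y : E ⟶ Y), FactorsThru N (g ≫ y) → FactorsThru N y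

namespace IsExtensionClosed

variable {N : Set C} (hN : IsExtensionClosed N)
include hN

lemma factorsThru_zero (X Y : C) : FactorsThru N (0 : X ⟶ Y) :=
  ⟨_, hN.zero _ (isZero_zero C), 0, 0, by simp⟩

lemma factorsThru_add {X Y : C} {f g : X ⟶ Y} (hf : FactorsThru N f) (hg : FactorsThru N g) :
    FactorsThru N (f + g) := by
  obtain ⟨P, hP, u, w, rfl⟩ := hf
  obtain ⟨P', hP', u', w', rfl⟩ := hg
  exact ⟨P ⊞ P', hN.ext _ (binaryBiproductTriangle_distinguished P P') hP hP',
    biprod.lift u u', biprod.desc w w', by simp⟩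

lemma factorsThru_of_sub {X Y : C} {f g : X ⟶ Y} (hfg : FactorsThru N (f - g))
    (hg : FactorsThru N g) : FactorsThru N f := by
  simpa using hN.factorsThru_add hfg hg

/-- The case of `isMonoMod_mor₂` where the first object belongs to `N`. -/
lemma isMonoMod_of_mem {P B E : C} {p : P ⟶ B} {g : B ⟶ E} {h : E ⟶ P⟦(1 : ℤ)⟧}
    (hT : Triangle.mk p g h ∈ distTriang C) (hP : P ∈ N) : IsMonoMod N g := by
  rintro X x ⟨M, hM, u, y, hxy⟩
  obtain ⟨W, i, q, hW⟩ := distinguished_cocone_triangle₂ (y ≫ h)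
  have hWN : W ∈ N := hN.ext _ hW hP hM
  obtain ⟨w, -, hw⟩ := DistTriangle.complete₂ hW hT (𝟙 P) y (by simp)
  obtain ⟨u', hu'⟩ := DistTriangle.lift₃ hW u (by
    have := DistTriangle.comp_zero₂₃ hT
    rw [← Category.assoc, ← hxy, Category.assoc, this, comp_zero])
  obtain ⟨z, hz⟩ := DistTriangle.lift₂ hT (x - u' ≫ w) (by
    rw [Preadditive.sub_comp, Category.assoc, ← hw, hxy, hu', Category.assoc, sub_self])
  refine hN.factorsThru_of_sub (g := u' ≫ w) ?_ ⟨W, hWN, u', w, rfl⟩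
  exact hz ▸ ⟨P, hP, z, p, rfl⟩

lemma isMonoMod_mor₂ {A B E : C} {f : A ⟶ B} {g : B ⟶ E} {h : E ⟶ A⟦(1 : ℤ)⟧}
    (hT : Triangle.mk f g h ∈ distTriang C) (hf : FactorsThru N f) : IsMonoMod N g := by
  intro X x hx
  obtain ⟨P, hP, a, p, rfl⟩ := hf
  obtain ⟨E', g', h', hT'⟩ := distinguished_cocone_triangle p
  obtain ⟨c, hc, -⟩ := DistTriangle.complete₃ hT hT' a (𝟙 B) (by simp)
  refine hN.isMonoMod_of_mem hT' hP x ?_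
  rw [Category.id_comp] at hc
  rw [← hc, ← Category.assoc]
  exact hx.comp_right c

/-- The case of `isEpiMod_mor₁` where the third object belongs to `N`. -/
lemma isEpiMod_of_mem {B E L : C} {g : B ⟶ E} {l : E ⟶ L} {h : L ⟶ B⟦(1 : ℤ)⟧}
    (hT : Triangle.mk g l h ∈ distTriang C) (hL : L ∈ N) : IsEpiMod N g := by
  rintro Y y ⟨M, hM, u, v, huv⟩
  obtain ⟨W, i, q, hW⟩ := distinguished_cocone_triangle₂ (h ≫ u⟦(1 : ℤ)⟧')
  have hWN : W ∈ N := hN.ext _ hW hM hL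
  obtain ⟨w, hw, -⟩ := DistTriangle.complete₂ hT hW u (𝟙 L) (by simp)
  obtain ⟨v', hv'⟩ := DistTriangle.exists_extension hW v (by
    have := DistTriangle.comp_zero₃₁ hT
    rw [Category.assoc, ← Functor.map_comp, ← huv, Functor.map_comp, ← Category.assoc, this,
      zero_comp])
  obtain ⟨z, hz⟩ := DistTriangle.desc₂ hT (y - w ≫ v') (by
    rw [Preadditive.comp_sub, ← Category.assoc, hw, huv, ← hv', Category.assoc, sub_self])
  refine hN.factorsThru_of_sub (g := w ≫ v') ?_ ⟨W, hWN, w, v', rfl⟩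
  exact hz ▸ ⟨L, hL, l, z, rfl⟩

lemma isEpiMod_mor₁ {B E L : C} {g : B ⟶ E} {l : E ⟶ L} {h : L ⟶ B⟦(1 : ℤ)⟧}
    (hT : Triangle.mk g l h ∈ distTriang C) (hl : FactorsThru N l) : IsEpiMod N g := by
  intro Y y hy
  obtain ⟨P, hP, a, p, rfl⟩ := hl
  obtain ⟨B', g', h', hT'⟩ := distinguished_cocone_triangle₁ a
  obtain ⟨c, hc, -⟩ := DistTriangle.complete₁ hT' hT (𝟙 E) p (by simp)
  refine hN.isEpiMod_of_mem hT' hP y ?_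
  rw [Category.comp_id] at hc
  rw [hc, Category.assoc]
  exact hy.comp_left c

/-- A morphism of `S_N` can be pulled back along any morphism, modulo `N`. -/
lemma exists_pullback_SN {B E X : C} {s : B ⟶ E} (hs : SN N s) (x : X ⟶ E) :
    ∃ (X' : C) (s' : X' ⟶ X) (w : X' ⟶ B), SN N s' ∧ FactorsThru N (s' ≫ x - w ≫ s) := by
  obtain ⟨A, f, h, hT, ⟨P, hP, a, p, rfl⟩, hh⟩ := hs
  obtain ⟨X₁, i₁, t, hX₁⟩ := distinguished_cocone_triangle₂ (x ≫ h)
  obtain ⟨X₂, i₂, s₂, hX₂⟩ := distinguished_cocone_triangle₂ ((x ≫ h) ≫ a⟦(1 : ℤ)⟧')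
  obtain ⟨V, c, j, hV⟩ := distinguished_cocone_triangle a
  have hxh : FactorsThru N (x ≫ h) := hh.comp_left x
  obtain ⟨e, he₁, he₂⟩ := DistTriangle.complete₂ hX₁ hX₂ a (𝟙 X) (by simp)
  obtain ⟨x', hx'₁, hx'₂⟩ :=
    DistTriangle.complete₂ hX₁ hT (𝟙 A) x (by simp)
  have ht : t ≫ x ≫ h = 0 := DistTriangle.comp_zero₂₃ hX₁
  have hhf : h ≫ a⟦(1 : ℤ)⟧' ≫ p⟦(1 : ℤ)⟧' = 0 := by
    simpa using DistTriangle.comp_zero₃₁ hT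
  have hac : a ≫ c = 0 := DistTriangle.comp_zero₁₂ hV
  have hcj : c ≫ j = 0 := DistTriangle.comp_zero₂₃ hV
  have his₁ : i₁ ≫ t = 0 := DistTriangle.comp_zero₁₂ hX₁
  have his₂ : i₂ ≫ s₂ = 0 := DistTriangle.comp_zero₁₂ hX₂
  obtain ⟨w₀, hw₀⟩ := DistTriangle.exists_extension hX₂ p (by simp [hhf])
  rw [Category.comp_id] at he₂
  rw [Category.id_comp] at hx'₁
  obtain ⟨r, hr⟩ := DistTriangle.desc₂ hX₁ (x' - e ≫ w₀) (by
    rw [Preadditive.comp_sub, hx'₁, ← Category.assoc, he₁, Category.assoc, hw₀, sub_self])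
  have hew : e ≫ (w₀ + s₂ ≫ r) = x' := by
    rw [Preadditive.comp_add, ← Category.assoc e s₂, ← he₂, ← hr]
    abel
  refine ⟨X₂, s₂, w₀ + s₂ ≫ r, ⟨P, i₂, _, hX₂, .of_mem_left _ hP, hxh.comp_right _⟩, ?_⟩
  have hed : e ≫ (s₂ ≫ x - (w₀ + s₂ ≫ r) ≫ s) = 0 := by
    rw [Preadditive.comp_sub, ← Category.assoc, ← Category.assoc, hew, ← he₂, hx'₂, sub_self]
  generalize s₂ ≫ x - (w₀ + s₂ ≫ r) ≫ s = d at hed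
  obtain ⟨n, hn⟩ := DistTriangle.desc₂ hV (i₂ ≫ d) (by
    rw [← Category.assoc, ← he₁, Category.assoc, hed, comp_zero])
  obtain ⟨z₀, hz₀⟩ := DistTriangle.exists_extension hX₂ c (by
    rw [Category.assoc, ← Functor.map_comp, hac, Functor.map_zero, comp_zero])
  obtain ⟨r', hr'⟩ := DistTriangle.desc₂ hX₁ (e ≫ z₀) (by
    rw [← Category.assoc, he₁, Category.assoc, hz₀, hac])
  obtain ⟨z, hiz, hez⟩ : ∃ z : X₂ ⟶ V, i₂ ≫ z = c ∧ e ≫ z = 0 :=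
    ⟨z₀ - s₂ ≫ r', by rw [Preadditive.comp_sub, hz₀, ← Category.assoc, his₂, zero_comp, sub_zero],
      by rw [Preadditive.comp_sub, hr', ← Category.assoc, he₂, sub_self]⟩
  -- a morphism killed by both `i₂` and `e` factors through the connecting morphism `x ≫ h`
  have key {Y : C} (y : X₂ ⟶ Y) (hy₁ : i₂ ≫ y = 0) (hy₂ : e ≫ y = 0) : FactorsThru N y := by
    obtain ⟨q, rfl⟩ := DistTriangle.desc₂ hX₂ y hy₁
    obtain ⟨m, rfl⟩ := DistTriangle.desc₃ hX₁ q (by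
      rw [he₂, Category.assoc, hy₂])
    exact (hxh.comp_right m).comp_left s₂
  have hz : FactorsThru N z := hN.isMonoMod_mor₂ (DistTriangle.rotate hV) (.of_mem_left _ hP) z
    (key _ (by rw [← Category.assoc]; exact hiz.symm ▸ hcj)
      (by rw [← Category.assoc, hez]; exact zero_comp))
  refine hN.factorsThru_of_sub (g := z ≫ n) (key _ ?_ ?_) (hz.comp_right n)
  · rw [Preadditive.comp_sub, hn, ← Category.assoc, hiz, sub_self]
  · rw [Preadditive.comp_sub, hed, ← Category.assoc, hez, zero_comp, sub_self]

/-- The epi-mono factorization modulo `N` of a morphism whose fibre belongs to `N⟦-1⟧ * N`. -/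
lemma exists_factorization {K A B N' N₀ : C} {k : K ⟶ A} {a : A ⟶ B} {b : B ⟶ K⟦(1 : ℤ)⟧}
    (hT : Triangle.mk k a b ∈ distTriang C) {u : N' ⟶ N₀} {v : N₀ ⟶ K⟦(1 : ℤ)⟧}
    {w : K⟦(1 : ℤ)⟧ ⟶ N'⟦(1 : ℤ)⟧} (hK : Triangle.mk u v w ∈ distTriang C)
    (hN' : N' ∈ N) :
    ∃ (Z : C) (p : A ⟶ Z) (q : Z ⟶ N₀) (h : N₀ ⟶ A⟦(1 : ℤ)⟧) (m : Z ⟶ B),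
      Triangle.mk p q h ∈ distTriang C ∧ p ≫ m = a ∧ IsMonoMod N m := by
  obtain ⟨Z, p, q, hZ⟩ := distinguished_cocone_triangle₂ (v ≫ k⟦(1 : ℤ)⟧')
  obtain ⟨m, hpm, hqm⟩ := DistTriangle.complete₂ hZ
    (DistTriangle.rotate hT) (𝟙 A) (-v) (by simp)
  rw [Category.id_comp] at hpm
  have hab : a ≫ b = 0 := DistTriangle.comp_zero₂₃ hT
  have hpq : p ≫ q = 0 := DistTriangle.comp_zero₁₂ hZ
  have huv : u ≫ v = 0 := DistTriangle.comp_zero₁₂ hK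
  have hkp : FactorsThru N (k ≫ p) := by
    obtain ⟨n, hn⟩ := DistTriangle.desc₃ hK ((k ≫ p)⟦(1 : ℤ)⟧') (by
      have : (v ≫ k⟦(1 : ℤ)⟧') ≫ p⟦(1 : ℤ)⟧' = 0 := DistTriangle.comp_zero₃₁ hZ
      rw [Functor.map_comp, ← Category.assoc, this])
    refine ⟨N', hN', (shiftFunctor C (1 : ℤ)).preimage w, (shiftFunctor C (1 : ℤ)).preimage n, ?_⟩
    apply (shiftFunctor C (1 : ℤ)).map_injective
    rw [hn, Functor.map_comp, Functor.map_preimage, Functor.map_preimage]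
  obtain ⟨z₀, hz₀⟩ := DistTriangle.lift₃ hZ u (by
    rw [← Category.assoc, huv, zero_comp])
  obtain ⟨t, ht⟩ := DistTriangle.lift₃ hT (z₀ ≫ m) (by
    rw [Category.assoc, ← hqm, ← Category.assoc, ← hz₀, Preadditive.comp_neg, huv, neg_zero])
  obtain ⟨z, hzm, hzq⟩ : ∃ z : N' ⟶ Z, z ≫ m = 0 ∧ z ≫ q = u :=
    ⟨z₀ - t ≫ p, by rw [Preadditive.sub_comp, Category.assoc, hpm, ht, sub_self],
      by rw [Preadditive.sub_comp, Category.assoc, hpq, comp_zero, sub_zero, hz₀]⟩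
  have key {X : C} (x : X ⟶ Z) (hx : x ≫ m = 0) : FactorsThru N x := by
    obtain ⟨y, hy⟩ := DistTriangle.lift₂ hK (x ≫ q) (by
      rw [Category.assoc, ← neg_eq_zero, ← Preadditive.comp_neg, ← Preadditive.comp_neg, hqm,
        ← Category.assoc, hx, zero_comp])
    obtain ⟨r, hr⟩ := DistTriangle.lift₂ hZ (x - y ≫ z) (by
      rw [Preadditive.sub_comp, hy, Category.assoc, hzq, sub_self])
    obtain ⟨r', rfl⟩ := DistTriangle.lift₂ hT r (by
      rw [← hpm, ← Category.assoc, ← hr, Preadditive.sub_comp, hx, Category.assoc, hzm,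
        comp_zero, sub_zero])
    refine hN.factorsThru_of_sub (g := y ≫ z) ?_ ⟨N', hN', y, z, rfl⟩
    rw [hr, Category.assoc]
    exact hkp.comp_left r'
  refine ⟨Z, p, q, _, m, hZ, hpm, fun X x ⟨M, hM, g₁, g₂, hg⟩ => ?_⟩
  obtain ⟨X', s, h, hs⟩ := distinguished_cocone_triangle₁ g₁
  refine hN.isEpiMod_of_mem hs hM x (key _ ?_)
  have : s ≫ g₁ = 0 := DistTriangle.comp_zero₁₂ hs
  rw [Category.assoc, hg, ← Category.assoc, this, zero_comp]

end IsExtensionClosed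

/-! ### The quotient of `C` by the ideal of morphisms factoring through `N` -/

/-- The relation on morphisms of `C` given by the ideal of morphisms factoring through `N`. -/
def homRelOf (N : Set C) : HomRel C := fun _ _ f g => FactorsThru N (f - g)

/-- The class of split epimorphisms with kernel in `N`. -/
def splitEpiOf (N : Set C) : MorphismProperty C := fun X Y f =>
  ∃ (P : C) (_ : P ∈ N) (i : P ⟶ X), Triangle.mk i f (0 : Y ⟶ P⟦(1 : ℤ)⟧) ∈ distTriang C

namespace IsExtensionClosed

variable {N : Set C} (hN : IsExtensionClosed N)
include hN

lemma congruence_homRelOf : Congruence (homRelOf N) where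
  equivalence :=
    { refl := fun f => by
        unfold homRelOf
        rw [sub_self]
        exact hN.factorsThru_zero _ _
      symm := fun {f g} hfg => by
        unfold homRelOf at hfg ⊢
        rw [← neg_sub]
        exact hfg.neg
      trans := fun {f g h} hfg hgh => by
        unfold homRelOf at hfg hgh ⊢
        rw [← sub_add_sub_cancel]
        exact hN.factorsThru_add hfg hgh }
  comp_left f g g' h := by
    unfold homRelOf at h ⊢
    rw [← Preadditive.comp_sub]
    exact h.comp_left f
  comp_right g h := by
    unfold homRelOf at h ⊢
    rw [← Preadditive.sub_comp]
    exact h.comp_right g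

lemma functor_map_eq_iff {X Y : C} (f g : X ⟶ Y) :
    (Quotient.functor (homRelOf N)).map f = (Quotient.functor (homRelOf N)).map g ↔
      FactorsThru N (f - g) := by
  have := hN.congruence_homRelOf
  exact Quotient.functor_map_eq_iff (homRelOf N) f g

lemma splitEpiOf_le : splitEpiOf N ≤ SNProp N := by
  rintro X Y f ⟨P, hP, i, hT⟩
  exact ⟨P, i, 0, hT, .of_mem_left _ hP, hN.factorsThru_zero _ _⟩

lemma isInvertedBy_functor :
    (splitEpiOf N).IsInvertedBy (Quotient.functor (homRelOf N)) := by
  rintro X Y f ⟨P, hP, i, hT⟩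
  obtain ⟨σ, hσ⟩ := DistTriangle.lift₃ hT (𝟙 Y) comp_zero
  obtain ⟨t, ht⟩ := DistTriangle.lift₂ hT (f ≫ σ - 𝟙 X) (by
    rw [Preadditive.sub_comp, Category.assoc, ← hσ, Category.comp_id, Category.id_comp, sub_self])
  refine ⟨(Quotient.functor (homRelOf N)).map σ, ?_, ?_⟩
  · rw [← Functor.map_comp, ← CategoryTheory.Functor.map_id, hN.functor_map_eq_iff]
    exact ⟨P, hP, t, i, ht⟩
  · rw [← Functor.map_comp, ← hσ, CategoryTheory.Functor.map_id]

omit hN in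
lemma map_eq_of_isInvertedBy {E : Type*} [Category* E] (F : C ⥤ E)
    (hF : (splitEpiOf N).IsInvertedBy F) {X Y : C} (f g : X ⟶ Y) (h : homRelOf N f g) :
    F.map f = F.map g := by
  obtain ⟨P, hP, u, w, huw⟩ := h
  have : IsIso (F.map (biprod.snd : P ⊞ X ⟶ X)) :=
    hF _ ⟨P, hP, biprod.inl, binaryBiproductTriangle_distinguished P X⟩
  have key : F.map (biprod.lift u (𝟙 X)) = F.map (biprod.lift 0 (𝟙 X)) := by
    rw [← cancel_mono (F.map (biprod.snd : P ⊞ X ⟶ X)), ← F.map_comp, ← F.map_comp,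
      biprod.lift_snd, biprod.lift_snd]
  have hf : f = biprod.lift u (𝟙 X) ≫ biprod.desc w g := by
    rw [biprod.lift_desc, Category.id_comp, ← huw, sub_add_cancel]
  have hg : g = biprod.lift 0 (𝟙 X) ≫ biprod.desc w g := by
    rw [biprod.lift_desc, Category.id_comp, zero_comp, zero_add]
  rw [hf, F.map_comp, key, ← F.map_comp, ← hg]

/-- The quotient functor satisfies the strict universal property of the localization with
respect to the split epimorphisms with kernel in `N`. -/
def strictUniversalProperty (E : Type*) [Category* E] :
    Localization.StrictUniversalPropertyFixedTarget (Quotient.functor (homRelOf N))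
      (splitEpiOf N) E where
  inverts := hN.isInvertedBy_functor
  lift F hF := CategoryTheory.Quotient.lift _ F (fun _ _ f g => map_eq_of_isInvertedBy F hF f g)
  fac F _ := CategoryTheory.Quotient.lift_spec _ F _
  uniq F₁ F₂ h := CategoryTheory.Quotient.lift_unique' _ F₁ F₂ h

lemma isLocalization_functor :
    (Quotient.functor (homRelOf N)).IsLocalization (splitEpiOf N) :=
  .mk' _ _ (hN.strictUniversalProperty _) (hN.strictUniversalProperty _)

end IsExtensionClosed

/-- The multiplicative closure of the image of `S_N` in the quotient category. -/
def SNClosure (N : Set C) : MorphismProperty (Quotient (homRelOf N)) :=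
  ((SNProp N).map (Quotient.functor (homRelOf N))).multiplicativeClosure

namespace IsExtensionClosed

variable {N : Set C} (hN : IsExtensionClosed N)
include hN

lemma exists_pullback_map_SNProp {X Y Z : Quotient (homRelOf N)} {s : Y ⟶ Z}
    (hs : (SNProp N).map (Quotient.functor (homRelOf N)) s) (f : X ⟶ Z) :
    ∃ (X' : Quotient (homRelOf N)) (s' : X' ⟶ X) (f' : X' ⟶ Y),
      SNClosure N s' ∧ s' ≫ f = f' ≫ s := by
  obtain ⟨Y₀, Z₀, s₀, hs₀, ⟨e⟩⟩ := hs
  obtain ⟨eY, eZ, he⟩ : ∃ (eY : (Quotient.functor (homRelOf N)).obj Y₀ ≅ Y)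
      (eZ : (Quotient.functor (homRelOf N)).obj Z₀ ≅ Z),
      eY.hom ≫ s = (Quotient.functor (homRelOf N)).map s₀ ≫ eZ.hom :=
    ⟨Arrow.leftFunc.mapIso e, Arrow.rightFunc.mapIso e, e.hom.w⟩
  obtain ⟨X⟩ := X
  obtain ⟨x, hx⟩ := (Quotient.functor (homRelOf N)).map_surjective (X := X) (Y := Z₀)
    (f ≫ eZ.inv)
  obtain ⟨X', s', w, hs', hw⟩ := hN.exists_pullback_SN hs₀ x
  refine ⟨_, (Quotient.functor (homRelOf N)).map s',
    (Quotient.functor (homRelOf N)).map w ≫ eY.hom,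
    .of _ (MorphismProperty.map_mem_map _ _ _ hs'), ?_⟩
  rw [← hN.functor_map_eq_iff, Functor.map_comp, Functor.map_comp, hx] at hw
  rw [Category.assoc, he, ← Category.assoc, ← hw, Category.assoc, Category.assoc,
    Iso.inv_hom_id, Category.comp_id]

lemma exists_pullback_SNClosure {X Y Z : Quotient (homRelOf N)} {s : Y ⟶ Z}
    (hs : SNClosure N s) (f : X ⟶ Z) :
    ∃ (X' : Quotient (homRelOf N)) (s' : X' ⟶ X) (f' : X' ⟶ Y),
      SNClosure N s' ∧ s' ≫ f = f' ≫ s := by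
  induction hs generalizing X with
  | of s hs => exact hN.exists_pullback_map_SNProp hs f
  | id Y => exact ⟨X, 𝟙 X, f, .id X, by simp⟩
  | comp_of s t _ ht ih =>
    obtain ⟨X₁, t', f₁, ht', h₁⟩ := hN.exists_pullback_map_SNProp ht f
    obtain ⟨X₂, s', f₂, hs', h₂⟩ := ih f₁
    refine ⟨X₂, s' ≫ t', f₂,
      MorphismProperty.comp_mem (MorphismProperty.multiplicativeClosure _) _ _ hs' ht', ?_⟩
    rw [Category.assoc, h₁, ← Category.assoc, h₂, Category.assoc]

lemma SNClosure_le_monomorphisms :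
    SNClosure N ≤ MorphismProperty.monomorphisms (Quotient (homRelOf N)) := by
  rw [SNClosure, MorphismProperty.multiplicativeClosure_le_iff, MorphismProperty.map_le_iff]
  rintro B E g ⟨A, f, h, hT, hf, -⟩
  refine ⟨fun {X} y z hyz => ?_⟩
  obtain ⟨X⟩ := X
  obtain ⟨y, rfl⟩ := (Quotient.functor (homRelOf N)).map_surjective (X := X) (Y := B) y
  obtain ⟨z, rfl⟩ := (Quotient.functor (homRelOf N)).map_surjective (X := X) (Y := B) z
  erw [← Functor.map_comp, ← Functor.map_comp] at hyz
  rw [hN.functor_map_eq_iff] at hyz ⊢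
  rw [← Preadditive.sub_comp] at hyz
  exact hN.isMonoMod_mor₂ hT hf _ hyz

lemma SNClosure_le_epimorphisms :
    SNClosure N ≤ MorphismProperty.epimorphisms (Quotient (homRelOf N)) := by
  rw [SNClosure, MorphismProperty.multiplicativeClosure_le_iff, MorphismProperty.map_le_iff]
  rintro B E g ⟨A, f, h, hT, -, hh⟩
  refine ⟨fun {Y} y z hyz => ?_⟩
  obtain ⟨Y⟩ := Y
  obtain ⟨y, rfl⟩ := (Quotient.functor (homRelOf N)).map_surjective (X := E) (Y := Y) y
  obtain ⟨z, rfl⟩ := (Quotient.functor (homRelOf N)).map_surjective (X := E) (Y := Y) z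
  erw [← Functor.map_comp, ← Functor.map_comp] at hyz
  rw [hN.functor_map_eq_iff] at hyz ⊢
  rw [← Preadditive.comp_sub] at hyz
  exact hN.isEpiMod_mor₁ (DistTriangle.rotate hT) hh _ hyz

lemma hasRightCalculusOfFractions_SNClosure : (SNClosure N).HasRightCalculusOfFractions where
  toIsMultiplicative := inferInstanceAs (MorphismProperty.multiplicativeClosure _).IsMultiplicative
  exists_rightFraction X Y φ := by
    obtain ⟨X', s', f', hs', h⟩ := hN.exists_pullback_SNClosure φ.hs φ.f
    exact ⟨⟨s', hs', f'⟩, h⟩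
  ext X Y Y' f₁ f₂ s hs h := by
    have : Mono s := hN.SNClosure_le_monomorphisms _ hs
    exact ⟨X, 𝟙 X, .id X, by rw [(cancel_mono s).1 h]⟩

end IsExtensionClosed

/-! ### Localization functors for `S_N` -/

section Localization

variable {N : Set C} (hN : IsExtensionClosed N) {D : Type u₂} [Category.{v₂} D]
  (Q : C ⥤ D) [Q.IsLocalization (SNProp N)]
include hN

/-- The functor induced on the quotient category by a localization functor for `S_N`. -/
def IsExtensionClosed.quotientLift : Quotient (homRelOf N) ⥤ D :=
  CategoryTheory.Quotient.lift _ Q (fun _ _ f g => IsExtensionClosed.map_eq_of_isInvertedBy Q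
    (MorphismProperty.IsInvertedBy.of_le _ _ _ (Localization.inverts Q (SNProp N)) hN.splitEpiOf_le)
    f g)

lemma IsExtensionClosed.isLocalization_quotientLift :
    (hN.quotientLift Q).IsLocalization (SNClosure N) := by
  have := hN.isLocalization_functor
  have hQ : (Quotient.functor (homRelOf N) ⋙ hN.quotientLift Q).IsLocalization (SNProp N) :=
    ‹Q.IsLocalization (SNProp N)›
  have := Functor.IsLocalization.of_comp (Quotient.functor (homRelOf N)) (hN.quotientLift Q)
    (splitEpiOf N) _ (SNProp N) hN.splitEpiOf_le rfl
  have : (𝟭 D).IsLocalization (⊥ : MorphismProperty D) := .for_id _ bot_le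
  refine Functor.IsLocalization.comp (hN.quotientLift Q) (𝟭 D)
    ((SNProp N).map (Quotient.functor (homRelOf N))) ⊥ (SNClosure N) ?_
    (MorphismProperty.le_multiplicativeClosure _) bot_le
  change ((SNProp N).map (Quotient.functor (homRelOf N))).multiplicativeClosure ≤
    (MorphismProperty.isomorphisms D).inverseImage (hN.quotientLift Q)
  rw [MorphismProperty.multiplicativeClosure_le_iff]
  exact Localization.inverts (hN.quotientLift Q) ((SNProp N).map (Quotient.functor (homRelOf N)))

lemma IsExtensionClosed.factorsThru_sub_of_map_eq {X Y : C} {f g : X ⟶ Y}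
    (h : Q.map f = Q.map g) : FactorsThru N (f - g) := by
  have := hN.isLocalization_quotientLift Q
  have := hN.hasRightCalculusOfFractions_SNClosure
  obtain ⟨Z, s, hs, h⟩ := (MorphismProperty.map_eq_iff_precomp (hN.quotientLift Q) (SNClosure N)
    ((Quotient.functor (homRelOf N)).map f) ((Quotient.functor (homRelOf N)).map g)).1 h
  have : Epi s := hN.SNClosure_le_epimorphisms _ hs
  exact (hN.functor_map_eq_iff f g).1 ((cancel_epi s).1 h)

lemma IsExtensionClosed.exists_rightFraction {X Y : C} (α : Q.obj X ⟶ Q.obj Y) :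
    ∃ (X' : C) (s : X' ⟶ X) (f : X' ⟶ Y), IsIso (Q.map s) ∧ Q.map s ≫ α = Q.map f := by
  have := hN.isLocalization_quotientLift Q
  have := hN.hasRightCalculusOfFractions_SNClosure
  obtain ⟨φ, rfl⟩ := Localization.exists_rightFraction (hN.quotientLift Q) (SNClosure N)
    (X := ⟨X⟩) (Y := ⟨Y⟩) α
  obtain ⟨s, hs⟩ := (Quotient.functor (homRelOf N)).map_surjective (X := φ.X'.as) (Y := X) φ.s
  obtain ⟨f, hf⟩ := (Quotient.functor (homRelOf N)).map_surjective (X := φ.X'.as) (Y := Y) φ.f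
  have hs' : Q.map s = (hN.quotientLift Q).map φ.s := congr_arg (hN.quotientLift Q).map hs
  have hf' : Q.map f = (hN.quotientLift Q).map φ.f := congr_arg (hN.quotientLift Q).map hf
  refine ⟨φ.X'.as, s, f, ?_, ?_⟩
  · rw [hs']
    exact Localization.inverts (hN.quotientLift Q) (SNClosure N) _ φ.hs
  · rw [hs', hf']
    exact φ.map_s_comp_map (hN.quotientLift Q) _

end Localization

section Additive

variable {N : Set C} (hN : IsExtensionClosed N) {D : Type u₂} [Category.{v₂} D] [Preadditive D]
  (Q : C ⥤ D) [Q.Additive] [Q.IsLocalization (SNProp N)]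
include hN

lemma IsExtensionClosed.map_eq_zero_iff {X Y : C} (f : X ⟶ Y) :
    Q.map f = 0 ↔ FactorsThru N f := by
  refine ⟨fun h => ?_, fun h => ?_⟩
  · simpa using hN.factorsThru_sub_of_map_eq Q (f := f) (g := 0) (by rw [h, Q.map_zero])
  · rw [← Q.map_zero X Y]
    exact IsExtensionClosed.map_eq_of_isInvertedBy Q
      (MorphismProperty.IsInvertedBy.of_le _ _ _ (Localization.inverts Q (SNProp N))
        hN.splitEpiOf_le) f 0 (by rwa [homRelOf, sub_zero])

lemma IsExtensionClosed.mono_map {X Y : C} {m : X ⟶ Y} (hm : IsMonoMod N m) :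
    Mono (Q.map m) := by
  have := Localization.essSurj Q (SNProp N)
  refine Preadditive.mono_of_cancel_zero _ fun {T} β hβ => ?_
  obtain ⟨X', s, b, _, hb⟩ := hN.exists_rightFraction Q ((Q.objObjPreimageIso T).hom ≫ β)
  have : Q.map b = 0 := (hN.map_eq_zero_iff Q b).2 (hm b ((hN.map_eq_zero_iff Q _).1 (by
    rw [Q.map_comp, ← hb, Category.assoc, Category.assoc, hβ, comp_zero, comp_zero])))
  rw [this, ← comp_zero (f := Q.map s), cancel_epi] at hb
  exact (cancel_epi (Q.objObjPreimageIso T).hom).1 (hb.trans comp_zero.symm)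

lemma IsExtensionClosed.epi_map {X Y L : C} {p : X ⟶ Y} {q : Y ⟶ L} {h : L ⟶ X⟦(1 : ℤ)⟧}
    (hT : Triangle.mk p q h ∈ distTriang C) (hL : L ∈ N) : Epi (Q.map p) := by
  have := Localization.essSurj Q (SNProp N)
  refine Preadditive.epi_of_cancel_zero _ fun {T} β hβ => ?_
  obtain ⟨Y', s, b, _, hb⟩ := hN.exists_rightFraction Q (β ≫ (Q.objObjPreimageIso T).inv)
  obtain ⟨X', p', h', hT'⟩ := distinguished_cocone_triangle₁ (s ≫ q)
  obtain ⟨i, hi⟩ := DistTriangle.lift₂ hT (p' ≫ s) (by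
    rw [Category.assoc, DistTriangle.comp_zero₁₂ hT'])
  have : Q.map b = 0 := (hN.map_eq_zero_iff Q b).2
    (hN.isEpiMod_of_mem hT' hL b ((hN.map_eq_zero_iff Q _).1 (by
      rw [Q.map_comp, ← hb, ← Category.assoc, ← Q.map_comp, hi, Q.map_comp, Category.assoc,
        ← Category.assoc (Q.map p), hβ, zero_comp, comp_zero])))
  rw [this, ← comp_zero (f := Q.map s), cancel_epi] at hb
  exact (cancel_mono (Q.objObjPreimageIso T).inv).1 (hb.trans zero_comp.symm)

end Additive

theorem stmt19 (N : Set C)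
    (hN0 : ∀ X : C, Limits.IsZero X → X ∈ N)
    (hNiso : ∀ ⦃X Y : C⦄, (X ≅ Y) → X ∈ N → Y ∈ N)
    (hNsum : ∀ ⦃X Z : C⦄ (i : X ⟶ Z) (r : Z ⟶ X), i ≫ r = 𝟙 X → Z ∈ N → X ∈ N)
    (hNext : ∀ (T : Triangle C), (T ∈ distTriang C) → T.obj₁ ∈ N → T.obj₃ ∈ N → T.obj₂ ∈ N)
    {D : Type u₂} [Category.{v₂} D] [Preadditive D] [HasZeroObject D]
    (Q : C ⥤ D) [Q.Additive] [Q.IsLocalization (SNProp N)]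
    (hCone : ∀ X : C, ∃ (N' N₀ : C) (_ : N' ∈ N) (_ : N₀ ∈ N)
      (u : N' ⟶ N₀) (v : N₀ ⟶ X) (w : X ⟶ N'⟦(1:ℤ)⟧),
        Triangle.mk u v w ∈ distTriang C)
    (A B : C) (α : Q.obj A ⟶ Q.obj B) :
    ∃ (Z : D) (α₁ : Q.obj A ⟶ Z) (α₂ : Z ⟶ Q.obj B),
      α = α₁ ≫ α₂ ∧ Epi α₁ ∧ Mono α₂ := by
  have hN : IsExtensionClosed N := ⟨hN0, hNext⟩
  obtain ⟨A', s, f, hs, hf⟩ := hN.exists_rightFraction Q α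
  obtain ⟨K, k, b, hT⟩ := distinguished_cocone_triangle₁ f
  obtain ⟨N', N₀, hN', hN₀, u, v, w, hK⟩ := hCone (K⟦(1 : ℤ)⟧)
  obtain ⟨Z, p, q, h, m, hZ, hpm, hm⟩ := hN.exists_factorization hT hK hN'
  have hp : Epi (Q.map p) := hN.epi_map Q hZ hN₀
  refine ⟨Q.obj Z, inv (Q.map s) ≫ Q.map p, Q.map m, ?_, inferInstance, hN.mono_map Q hm⟩
  rw [Category.assoc, ← Q.map_comp, hpm, ← hf, IsIso.inv_hom_id_assoc]
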